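/- Let M > 0 and p > 0. Then for all a, b ≥ 0 one has 1 + (M/(a+b+M))^p ≥ (M/(a+M))^p + (M/(b+M))^p, and the inequality is strict whenever a > 0 and b > 0. -/

import Mathlib

/-- The scalar inequality `1 + (M/(a+b+M))^p ≥ (M/(a+M))^p + (M/(b+M))^p` for
`M > 0`, `p > 0`, `a, b ≥ 0`, with strict inequality when `a > 0` and `b > 0`. -/
theorem stmt7 (M p : ℝ) (hM : 0 < M) (hp : 0 < p) :
    (∀ a b : ℝ, 0 ≤ a → 0 ≤ b →
      (M / (a + M)) ^ p + (M / (b + M)) ^ p ≤ 1 + (M / (a + b + M)) ^ p) ∧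
    (∀ a b : ℝ, 0 < a → 0 < b →
      (M / (a + M)) ^ p + (M / (b + M)) ^ p < 1 + (M / (a + b + M)) ^ p) := by
  have key : ∀ a : ℝ, 0 ≤ a → (M / (a + M)) ^ p ≤ 1 := fun a ha =>
    Real.rpow_le_one (by positivity) ((div_le_one (by positivity)).2 (by linarith)) hp.le
  constructor
  · intro a b ha hb
    have h : (M / (a + M) * (M / (b + M))) ^ p ≤ (M / (a + b + M)) ^ p := by
      apply Real.rpow_le_rpow (by positivity) _ hp.le
      rw [div_mul_div_comm, div_le_div_iff₀ (by positivity) (by positivity)]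
      nlinarith [mul_nonneg hM.le (mul_nonneg ha hb)]
    rw [Real.mul_rpow (by positivity) (by positivity)] at h
    nlinarith [mul_nonneg (sub_nonneg.2 (key a ha)) (sub_nonneg.2 (key b hb))]
  · intro a b ha hb
    have h : (M / (a + M) * (M / (b + M))) ^ p < (M / (a + b + M)) ^ p := by
      apply Real.rpow_lt_rpow (by positivity) _ hp
      rw [div_mul_div_comm, div_lt_div_iff₀ (by positivity) (by positivity)]
      nlinarith [mul_pos hM (mul_pos ha hb)]
    rw [Real.mul_rpow (by positivity) (by positivity)] at h
    nlinarith [mul_nonneg (sub_nonneg.2 (key a ha.le)) (sub_nonneg.2 (key b hb.le))]
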